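/- Let a be a real number with √2 − 1 ≤ a ≤ √2 + 1 and a ≠ 1, and let A be the 2×2 matrix [[1, a], [a, 1]]. Then prank(A) = 2 and prank(A ⊗ A) ≤ 3; in particular prank(A ⊗ A) < prank(A)², so PSD-rank is strictly sub-multiplicative under Kronecker product. -/

import Mathlib

open scoped ComplexOrder

/-- The PSD-rank of a nonnegative real matrix: the smallest `r` such that there exist
`r × r` complex Hermitian positive semidefinite matrices `E i` and `F j` with
`A i j = Tr (E i * F j)` for all `i, j`. -/
noncomputable def prank {α β : Type*} [Fintype α] [Fintype β] (A : Matrix α β ℝ) : ℕ :=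
  sInf {r : ℕ |
    ∃ (E : α → Matrix (Fin r) (Fin r) ℂ) (F : β → Matrix (Fin r) (Fin r) ℂ),
      (∀ i, (E i).PosSemidef) ∧ (∀ j, (F j).PosSemidef) ∧
      ∀ i j, (A i j : ℂ) = ((E i) * (F j)).trace}

open Kronecker in
lemma prank_aux_le {α β : Type*} [Fintype α] [Fintype β] (A : Matrix α β ℝ) (r : ℕ)
    (E : α → Matrix (Fin r) (Fin r) ℂ) (F : β → Matrix (Fin r) (Fin r) ℂ)
    (hE : ∀ i, (E i).PosSemidef) (hF : ∀ j, (F j).PosSemidef)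
    (h : ∀ i j, (A i j : ℂ) = ((E i) * (F j)).trace) : prank A ≤ r :=
  Nat.sInf_le ⟨E, F, hE, hF, h⟩

lemma prank_aux_two (a : ℝ) (h0 : 0 < a) (ha : a ≠ 1) :
    prank (!![1, a; a, 1]) = 2 := by
  have hmem : 2 ∈ {r : ℕ |
    ∃ (E : Fin 2 → Matrix (Fin r) (Fin r) ℂ) (F : Fin 2 → Matrix (Fin r) (Fin r) ℂ),
      (∀ i, (E i).PosSemidef) ∧ (∀ j, (F j).PosSemidef) ∧
      ∀ i j, ((!![1, a; a, 1] : Matrix (Fin 2) (Fin 2) ℝ) i j : ℂ) = ((E i) * (F j)).trace} := by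
    have h0' : (0 : ℂ) ≤ (a : ℂ) := by exact_mod_cast h0.le
    refine ⟨![Matrix.diagonal ![1, (a : ℂ)], Matrix.diagonal ![(a : ℂ), 1]],
      ![Matrix.diagonal ![1, 0], Matrix.diagonal ![0, 1]], ?_, ?_, ?_⟩
    · intro i
      fin_cases i <;> refine Matrix.PosSemidef.diagonal ?_ <;> intro k <;> fin_cases k <;> simp [h0.le]
    · intro i
      fin_cases i <;> refine Matrix.PosSemidef.diagonal ?_ <;> intro k <;> fin_cases k <;> simp
    · intro i j
      fin_cases i <;> fin_cases j <;> simp [Matrix.trace, Fin.sum_univ_two]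
  apply le_antisymm
  · exact Nat.sInf_le hmem
  · refine le_csInf ⟨2, hmem⟩ ?_
    rintro r ⟨E, F, -, -, h⟩
    by_contra hr
    have h00 := h 0 0
    have h01 := h 0 1
    have h10 := h 1 0
    have h11 := h 1 1
    have hr' : r = 0 ∨ r = 1 := by omega
    rcases hr' with rfl | rfl
    · simp at h00
    · simp [Matrix.trace, Matrix.mul_apply] at h00 h01 h10 h11
      have : (a : ℂ) * a = 1 := by
        linear_combination (a : ℂ) * h01 + (E 0 0 0 * F 1 0 0) * h10 - h11 - (E 1 0 0 * F 1 0 0) * h00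
      have h2 : a * a = 1 := by exact_mod_cast this
      apply ha
      nlinarith

noncomputable def auxU : Fin 2 × Fin 2 → ℂ × ℂ := fun p =>
  !![((1 : ℂ), (0 : ℂ)), (0, 1); (0, -1), (-1, 0)] p.1 p.2

noncomputable def auxV (t : ℂ) (s : ℂ) (p : Fin 2 × Fin 2) : Fin 3 → ℂ :=
  ![t * (auxU p).1, t * (auxU p).2, s]

open Kronecker in
lemma prank_aux_three (a : ℝ) (h0 : 0 < a) (h8 : (1 + a) ^ 2 ≤ 8 * a) :
    prank ((!![1, a; a, 1]) ⊗ₖ (!![1, a; a, 1])) ≤ 3 := by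
  have hc : 0 ≤ (1 - a) ^ 2 * (8 * a - (1 + a) ^ 2) / (16 * a) := by
    have : 0 ≤ 8 * a - (1 + a) ^ 2 := by linarith
    positivity
  have hac : (a : ℂ) ≠ 0 := by exact_mod_cast h0.ne'
  refine prank_aux_le _ 3
    (fun p => (((1 - a) ^ 2 * (8 * a - (1 + a) ^ 2) / (16 * a) : ℝ) : ℂ) •
        Matrix.vecMulVec (auxV 1 0 p) (star (auxV 1 0 p)) +
      (a : ℂ) • Matrix.vecMulVec (auxV (((1 - a ^ 2) / (4 * a) : ℝ) : ℂ) 1 p)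
        (star (auxV (((1 - a ^ 2) / (4 * a) : ℝ) : ℂ) 1 p)))
    (fun p => Matrix.vecMulVec (auxV 1 1 p) (star (auxV 1 1 p))) ?_ ?_ ?_
  · intro p
    refine Matrix.PosSemidef.add ?_ ?_
    · exact (Matrix.posSemidef_vecMulVec_self_star _).smul (by exact_mod_cast hc)
    · exact (Matrix.posSemidef_vecMulVec_self_star _).smul (by exact_mod_cast h0.le)
  · intro p
    exact Matrix.posSemidef_vecMulVec_self_star _
  · rintro ⟨i, i'⟩ ⟨j, j'⟩
    simp only [Matrix.trace, Matrix.diag_apply, Matrix.mul_apply, Matrix.add_apply,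
      Matrix.smul_apply, Matrix.vecMulVec_apply, Fin.sum_univ_three, Pi.star_apply,
      Matrix.kroneckerMap_apply, smul_eq_mul]
    fin_cases i <;> fin_cases i' <;> fin_cases j <;> fin_cases j' <;>
      simp [auxV, auxU] <;>
      field_simp <;> ring

open Kronecker in
/-- For `√2 - 1 ≤ a ≤ √2 + 1`, `a ≠ 1`, the matrix `A = [[1,a],[a,1]]` has
`prank A = 2` and `prank (A ⊗ A) ≤ 3 < prank(A)²`: PSD-rank is strictly
sub-multiplicative under Kronecker product. -/
theorem prank_strictly_submultiplicative (a : ℝ)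
    (ha₁ : Real.sqrt 2 - 1 ≤ a) (ha₂ : a ≤ Real.sqrt 2 + 1) (ha : a ≠ 1) :
    prank (!![1, a; a, 1]) = 2 ∧
    prank ((!![1, a; a, 1]) ⊗ₖ (!![1, a; a, 1])) ≤ 3 ∧
    prank ((!![1, a; a, 1]) ⊗ₖ (!![1, a; a, 1])) < (prank (!![1, a; a, 1])) ^ 2 := by
  have hs : Real.sqrt 2 * Real.sqrt 2 = 2 := Real.mul_self_sqrt (by norm_num)
  have hs1 : 1 < Real.sqrt 2 := by
    have := Real.sqrt_nonneg 2
    nlinarith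
  have hs2 : Real.sqrt 2 < 2 := by nlinarith
  have h0 : 0 < a := by linarith
  have h8 : (1 + a) ^ 2 ≤ 8 * a := by
    nlinarith [mul_nonneg (sub_nonneg.2 ha₁) (sub_nonneg.2 ha₂), mul_pos h0 (sub_pos.2 hs2)]
  have e2 := prank_aux_two a h0 ha
  have e3 := prank_aux_three a h0 h8
  refine ⟨e2, e3, ?_⟩
  rw [e2]
  omega
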